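/- Let λ > 1 and n ≥ 1, let m := ⌈n/λ⌉, and let A = (a_{ij}) be an n×n matrix with 0 ≤ a_{ij} ≤ λ for all i, j and every row sum equal to n. Then perm(A) ≤ λⁿ · (m!)^{n/m}. -/

import Mathlib

noncomputable section

/-- The permanent of an `n × n` real matrix. -/
def permanent {n : ℕ} (M : Matrix (Fin n) (Fin n) ℝ) : ℝ :=
  ∑ π : Equiv.Perm (Fin n), ∏ i, M i (π i)

/-- The logarithm of `(r!)^{1/r}`, with value `0` at `r = 0`. -/
def logFactorialMean (r : ℕ) : ℝ := Real.log (r.factorial : ℝ) / r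

theorem mul_logFactorialMean (r : ℕ) :
    (r : ℝ) * logFactorialMean r = Real.log (r.factorial : ℝ) := by
  rcases Nat.eq_zero_or_pos r with rfl | h
  · simp
  · unfold logFactorialMean
    field_simp

/-- The bijections `e : α ≃ β` with `e a ∈ R a` for all `a`. -/
def transversals {α β : Type*} [Fintype α] [Fintype β] [DecidableEq α] [DecidableEq β]
    (R : α → Finset β) : Finset (α ≃ β) :=
  Finset.univ.filter fun e => ∀ a, e a ∈ R a

/-- The row supports after deleting row `i` and column `k`. -/
def minorRows {α β : Type*} [DecidableEq β] (R : α → Finset β) (i : α) (k : β) :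
    {a // a ≠ i} → Finset {b // b ≠ k} :=
  fun a => (R a).subtype (· ≠ k)

theorem card_minorRows {α β : Type*} [DecidableEq β] (R : α → Finset β) (i : α) (k : β)
    (a : {a // a ≠ i}) : (minorRows R i k a).card = ((R a).erase k).card := by
  rw [minorRows, Finset.card_subtype, Finset.filter_ne']

theorem card_transversals_fiber_le {α β : Type*} [Fintype α] [Fintype β] [DecidableEq α]
    [DecidableEq β] (R : α → Finset β) (i : α) (k : β) :
    ((transversals R).filter fun e => e i = k).card ≤ (transversals (minorRows R i k)).card := by
  have key : ∀ (e : α ≃ β) a, a ≠ i ↔ e.trans (Equiv.swap (e i) k) a ≠ k := by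
    intro e a
    rw [not_iff_not, Equiv.trans_apply, Equiv.swap_apply_eq_iff, Equiv.swap_apply_right,
      e.apply_eq_iff_eq]
  refine Finset.card_le_card_of_injOn
    (fun e => (e.trans (Equiv.swap (e i) k)).subtypeEquiv (key e)) ?_ ?_
  · intro e he
    obtain ⟨heR, rfl⟩ := Finset.mem_filter.1 he
    simp only [transversals, Finset.mem_filter, Finset.mem_univ, true_and] at heR
    simp only [transversals, Finset.coe_filter, Finset.mem_univ, true_and, Set.mem_ofPred_eq]
    intro a
    simpa [minorRows] using heR a
  · intro e he e' he' h
    have hk := (Finset.mem_filter.1 he).2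
    have hk' := (Finset.mem_filter.1 he').2
    ext a
    by_cases ha : a = i
    · rw [ha, hk, hk']
    · simpa [hk, hk'] using congrArg Subtype.val (Equiv.congr_fun h ⟨a, ha⟩)

/-- Jensen's inequality for `x ↦ x log x`, unnormalised. -/
theorem sum_mul_log_sum_le {β : Type*} (s : Finset β) (x : β → ℝ) (hx : ∀ b ∈ s, 0 ≤ x b)
    (hpos : 0 < ∑ b ∈ s, x b) :
    (∑ b ∈ s, x b) * Real.log (∑ b ∈ s, x b) ≤
      (∑ b ∈ s, x b) * Real.log s.card + ∑ b ∈ s, x b * Real.log (x b) := by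
  have hs : (0 : ℝ) < s.card := by
    rcases s.eq_empty_or_nonempty with rfl | h
    · simp at hpos
    · exact_mod_cast h.card_pos
  have h := Real.convexOn_mul_log.map_sum_le (t := s) (w := fun _ => (s.card : ℝ)⁻¹) (p := x)
    (fun _ _ => by positivity) (by simp [hs.ne']) (fun b hb => hx b hb)
  simp only [smul_eq_mul, ← Finset.mul_sum] at h
  rw [Real.log_mul (by positivity) hpos.ne', Real.log_inv] at h
  rw [mul_assoc] at h
  have := le_of_mul_le_mul_left h (inv_pos.2 hs)
  linarith

theorem sum_logFactorialMean_erase {α β : Type*} [Fintype α] [Fintype β] [DecidableEq α]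
    [DecidableEq β] (s : Finset β) (e : α ≃ β) (j : α) (hj : e j ∈ s) :
    ∑ i ∈ Finset.univ.erase j, logFactorialMean (s.erase (e i)).card =
      Fintype.card α * logFactorialMean s.card - Real.log s.card := by
  have hs : 0 < s.card := Finset.card_pos.2 ⟨_, hj⟩
  rw [eq_sub_of_add_eq (Finset.sum_erase_add Finset.univ
      (fun i => logFactorialMean (s.erase (e i)).card) (Finset.mem_univ j)),
    e.sum_comp fun b => logFactorialMean (s.erase b).card,
    ← Finset.sum_add_sum_compl s, Finset.card_erase_of_mem hj,
    Finset.sum_congr rfl fun b hb => by rw [Finset.card_erase_of_mem hb],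
    Finset.sum_congr (s₁ := sᶜ) rfl fun b hb => by
      rw [Finset.erase_eq_of_notMem (Finset.mem_compl.1 hb)]]
  simp only [Finset.sum_const, nsmul_eq_mul, Finset.card_compl]
  rw [Nat.cast_sub (Finset.card_le_univ s), Fintype.card_congr e]
  obtain ⟨r, hr⟩ := Nat.exists_eq_succ_of_ne_zero hs.ne'
  rw [hr]
  have h1 := mul_logFactorialMean r
  have h2 := mul_logFactorialMean (r + 1)
  rw [Nat.factorial_succ, Nat.cast_mul, Real.log_mul (by positivity) (by positivity)] at h2
  push_cast at *
  linarith

/-- The Bregman–Minc inequality, by Schrijver's convexity argument. -/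
theorem card_transversals_le {α β : Type*} [Fintype α] [Fintype β] [DecidableEq α]
    [DecidableEq β] (R : α → Finset β) :
    ((transversals R).card : ℝ) ≤ Real.exp (∑ a, logFactorialMean (R a).card) := by
  induction hn : Fintype.card α generalizing α β with
  | zero =>
    have := Fintype.card_eq_zero_iff.1 hn
    have h : (transversals R).card ≤ 1 := by
      refine Finset.card_le_one.2 fun e _ e' _ => ?_
      ext a
      exact isEmptyElim a
    simpa using h
  | succ n ih =>
    rcases (transversals R).eq_empty_or_nonempty with hS | hS
    · rw [hS]
      simp [Real.exp_nonneg]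
    set S := transversals R
    have hmem : ∀ e ∈ S, ∀ a, e a ∈ R a := fun e he => (Finset.mem_filter.1 he).2
    have hP : (0 : ℝ) < S.card := by exact_mod_cast hS.card_pos
    rw [← Real.log_le_iff_le_exp hP]
    set x : α → β → ℝ := fun i k => ((S.filter fun e => e i = k).card : ℝ) with hx
    have hsum : ∀ i, (S.card : ℝ) = ∑ k ∈ R i, x i k := fun i => by
      rw [Finset.card_eq_sum_card_fiberwise (f := fun e => e i) (t := R i)
        (fun e he => hmem e he i)]
      push_cast
      rfl
    have hent : ∀ i, ∑ k ∈ R i, x i k * Real.log (x i k) = ∑ e ∈ S, Real.log (x i (e i)) := by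
      intro i
      rw [← Finset.sum_fiberwise_of_maps_to (g := fun e : α ≃ β => e i) (t := R i)
        (fun e he => hmem e he i)]
      refine Finset.sum_congr rfl fun k _ => ?_
      rw [Finset.sum_congr rfl fun e he => by rw [(Finset.mem_filter.1 he).2]]
      simp [hx]
    have hlog : ∀ e ∈ S, ∀ i, Real.log (x i (e i)) ≤
        ∑ j ∈ Finset.univ.erase i, logFactorialMean ((R j).erase (e i)).card := by
      intro e he i
      have hpos : 0 < x i (e i) := by
        have : 0 < (S.filter fun e' => e' i = e i).card :=
          Finset.card_pos.2 ⟨e, Finset.mem_filter.2 ⟨he, rfl⟩⟩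
        exact Nat.cast_pos.2 this
      rw [Real.log_le_iff_le_exp hpos]
      have h1 : x i (e i) ≤ ((transversals (minorRows R i (e i))).card : ℝ) :=
        Nat.cast_le.2 (card_transversals_fiber_le R i (e i))
      refine h1.trans ((ih (minorRows R i (e i)) (by simp [hn])).trans_eq ?_)
      simp only [card_minorRows]
      rw [Finset.sum_subtype (Finset.univ.erase i) (p := (· ≠ i)) (by simp)
        fun j => logFactorialMean ((R j).erase (e i)).card]
    have hrow : ∀ i, (S.card : ℝ) * Real.log S.card ≤
        S.card * Real.log (R i).card + ∑ e ∈ S, Real.log (x i (e i)) := by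
      intro i
      have := sum_mul_log_sum_le (R i) (x i) (fun _ _ => Nat.cast_nonneg _) (by rwa [← hsum])
      rwa [← hsum, hent] at this
    have hper : ∀ e ∈ S, ∑ i, (Real.log (R i).card + Real.log (x i (e i))) ≤
        (n + 1) * ∑ i, logFactorialMean (R i).card := by
      intro e he
      have h1 : ∑ i, Real.log (x i (e i)) ≤
          ∑ j, ∑ i ∈ Finset.univ.erase j, logFactorialMean ((R j).erase (e i)).card := by
        refine (Finset.sum_le_sum fun i _ => hlog e he i).trans_eq ?_
        exact Finset.sum_comm' (by simp [eq_comm])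
      rw [Finset.sum_congr rfl fun j _ => sum_logFactorialMean_erase (R j) e j (hmem e he j),
        Finset.sum_sub_distrib, ← Finset.mul_sum, hn] at h1
      rw [Finset.sum_add_distrib]
      push_cast at h1
      linarith
    have htot := Finset.sum_le_sum fun i (_ : i ∈ Finset.univ) => hrow i
    have hper' := Finset.sum_le_sum hper
    rw [Finset.sum_comm] at hper'
    simp only [Finset.sum_add_distrib, Finset.sum_const, nsmul_eq_mul, Finset.card_univ, hn,
      ← Finset.mul_sum] at htot hper'
    push_cast at htot
    have h : (n + 1 : ℝ) * S.card * Real.log S.card ≤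
        (n + 1 : ℝ) * S.card * ∑ i, logFactorialMean (R i).card := by linarith
    exact le_of_mul_le_mul_left h (by positivity)

/-- A linear functional on `{x ∈ [0,1]^ι | ∑ x ≤ m}` with nonnegative coefficients is at most its
value at the indicator vector of some `m`-element set. -/
theorem exists_card_eq_sum_mul_le {ι : Type*} [Fintype ι] [DecidableEq ι] (c : ι → ℝ)
    (hc : ∀ j, 0 ≤ c j) (m : ℕ) (hm : m ≤ Fintype.card ι) :
    ∃ T : Finset ι, T.card = m ∧ ∀ x : ι → ℝ, (∀ j, 0 ≤ x j) → (∀ j, x j ≤ 1) →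
      ∑ j, x j ≤ m → ∑ j, x j * c j ≤ ∑ j ∈ T, c j := by
  have hne : (Finset.powersetCard m (Finset.univ : Finset ι)).Nonempty :=
    Finset.powersetCard_nonempty.2 (by simpa using hm)
  obtain ⟨T, hT, hmax⟩ := Finset.exists_max_image _ (fun T => ∑ j ∈ T, c j) hne
  have hTc := (Finset.mem_powersetCard.1 hT).2
  have hswap : ∀ j ∈ T, ∀ k ∉ T, c k ≤ c j := by
    intro j hj k hk
    have hk' : k ∉ T.erase j := fun h => hk (Finset.mem_of_mem_erase h)
    have := hmax (insert k (T.erase j)) (Finset.mem_powersetCard.2 ⟨Finset.subset_univ _, by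
      rw [Finset.card_insert_of_notMem hk', Finset.card_erase_add_one hj, hTc]⟩)
    rw [Finset.sum_insert hk', ← Finset.add_sum_erase T c hj] at this
    linarith
  obtain ⟨t, ht0, htT, htc⟩ : ∃ t, 0 ≤ t ∧ (∀ j ∈ T, t ≤ c j) ∧ ∀ k ∉ T, c k ≤ t := by
    rcases T.eq_empty_or_nonempty with rfl | hTne
    · exact ⟨∑ j, c j, Finset.sum_nonneg fun j _ => hc j, by simp, fun k _ =>
        Finset.single_le_sum (fun j _ => hc j) (Finset.mem_univ k)⟩
    · obtain ⟨j, hj, hmin⟩ := T.exists_min_image c hTne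
      exact ⟨c j, hc j, hmin, hswap j hj⟩
  refine ⟨T, hTc, fun x hx0 hx1 hxm => ?_⟩
  have h1 : ∑ j ∈ T, (1 - x j) * t ≤ ∑ j ∈ T, (1 - x j) * c j :=
    Finset.sum_le_sum fun j hj => mul_le_mul_of_nonneg_left (htT j hj) (by linarith [hx1 j])
  have h2 : ∑ j ∈ Tᶜ, x j * c j ≤ ∑ j ∈ Tᶜ, x j * t :=
    Finset.sum_le_sum fun j hj =>
      mul_le_mul_of_nonneg_left (htc j (Finset.mem_compl.1 hj)) (hx0 j)
  simp only [sub_mul, one_mul, Finset.sum_sub_distrib, Finset.sum_const, nsmul_eq_mul, hTc,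
    ← Finset.sum_mul] at h1 h2
  rw [← Finset.sum_add_sum_compl T] at hxm ⊢
  nlinarith [mul_le_mul_of_nonneg_right hxm ht0]

/-- The permanent is linear in row `i`, with coefficients not depending on that row. -/
theorem exists_permanent_updateRow {n : ℕ} (A : Matrix (Fin n) (Fin n) ℝ) (h0 : ∀ i j, 0 ≤ A i j)
    (i : Fin n) :
    ∃ c : Fin n → ℝ, (∀ j, 0 ≤ c j) ∧ ∀ x, permanent (A.updateRow i x) = ∑ j, x j * c j := by
  refine ⟨fun j => ∑ π ∈ Finset.univ.filter (fun π : Equiv.Perm (Fin n) => π i = j),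
    ∏ k ∈ Finset.univ.erase i, A k (π k), fun j => Finset.sum_nonneg fun π _ =>
      Finset.prod_nonneg fun k _ => h0 _ _, fun x => ?_⟩
  rw [permanent, ← Finset.sum_fiberwise _ (fun π : Equiv.Perm (Fin n) => π i)]
  refine Finset.sum_congr rfl fun j _ => ?_
  rw [Finset.mul_sum]
  refine Finset.sum_congr rfl fun π hπ => ?_
  rw [← Finset.mul_prod_erase _ _ (Finset.mem_univ i), Matrix.updateRow_self,
    (Finset.mem_filter.1 hπ).2]
  congr 1
  exact Finset.prod_congr rfl fun k hk => by
    rw [Matrix.updateRow_ne (Finset.ne_of_mem_erase hk)]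

/-- Rows with entries in `[0,1]` and sum at most `m` may be replaced by indicator vectors of
`m`-element sets without decreasing the permanent. -/
theorem exists_permanent_le_indicator {n m : ℕ} (hm : m ≤ n) (A : Matrix (Fin n) (Fin n) ℝ)
    (h0 : ∀ i j, 0 ≤ A i j) (h1 : ∀ i j, A i j ≤ 1) (hrow : ∀ i, ∑ j, A i j ≤ m) :
    ∃ R : Fin n → Finset (Fin n), (∀ i, (R i).card = m) ∧
      permanent A ≤ permanent (Matrix.of fun i j => if j ∈ R i then 1 else 0) := by
  have key : ∀ s : Finset (Fin n), ∃ R : Fin n → Finset (Fin n), (∀ i ∈ s, (R i).card = m) ∧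
      permanent A ≤
        permanent (Matrix.of fun i j => if i ∈ s then (if j ∈ R i then 1 else 0) else A i j) := by
    intro s
    induction s using Finset.induction_on with
    | empty => exact ⟨fun _ => ∅, by simp, by simp [permanent]⟩
    | insert i s hi ih =>
      obtain ⟨R, hR, hle⟩ := ih
      set B : Matrix (Fin n) (Fin n) ℝ :=
        Matrix.of fun i j => if i ∈ s then (if j ∈ R i then 1 else 0) else A i j with hB
      have hB0 : ∀ i j, 0 ≤ B i j := by
        intro i j
        simp only [hB, Matrix.of_apply]
        split_ifs <;> simp [h0]
      obtain ⟨c, hc, hlin⟩ := exists_permanent_updateRow B hB0 i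
      obtain ⟨T, hT, hmax⟩ := exists_card_eq_sum_mul_le c hc m (by simpa using hm)
      refine ⟨Function.update R i T, fun k hk => ?_, hle.trans ?_⟩
      · rcases eq_or_ne k i with rfl | hki
        · simpa using hT
        · rw [Function.update_of_ne hki]
          exact hR k (Finset.mem_of_mem_insert_of_ne hk hki)
      · have hBi : B = B.updateRow i (A i) := by
          ext k j
          rcases eq_or_ne k i with rfl | hki
          · simp [hB, hi]
          · simp [hki]
        have hBT : (Matrix.of fun k j => if k ∈ insert i s then
            (if j ∈ Function.update R i T k then 1 else 0) else A k j) =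
              B.updateRow i (fun j => if j ∈ T then 1 else 0) := by
          ext k j
          rcases eq_or_ne k i with rfl | hki
          · simp
          · simp [hki, hB]
        rw [hBT, hBi, Matrix.updateRow_idem, hlin, hlin]
        refine (hmax _ (h0 i) (h1 i) (hrow i)).trans_eq ?_
        simp
  obtain ⟨R, hR, hle⟩ := key Finset.univ
  exact ⟨R, fun i => hR i (Finset.mem_univ i), by simpa using hle⟩

theorem permanent_indicator {n : ℕ} (R : Fin n → Finset (Fin n)) :
    permanent (Matrix.of fun i j => if j ∈ R i then 1 else 0) = (transversals R).card := by
  simp only [permanent, transversals, Matrix.of_apply, Finset.prod_boole, Finset.mem_univ,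
    true_implies, Finset.sum_boole]
  congr!

theorem permanent_smul {n : ℕ} (c : ℝ) (A : Matrix (Fin n) (Fin n) ℝ) :
    permanent (c • A) = c ^ n * permanent A := by
  simp [permanent, Finset.prod_mul_distrib, Finset.mul_sum]

/-- Bregman–Minc-type bound `perm(A) ≤ λⁿ (m!)^{n/m}` with `m = ⌈n/λ⌉`. -/
theorem perm_le_pow_factorial (lam : ℝ) (hlam : 1 < lam) (n : ℕ) (hn : 1 ≤ n)
    (A : Matrix (Fin n) (Fin n) ℝ)
    (h0 : ∀ i j, 0 ≤ A i j) (hbd : ∀ i j, A i j ≤ lam)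
    (hrow : ∀ i, ∑ j, A i j = n) :
    permanent A ≤ lam ^ n *
      ((Nat.factorial ⌈(n : ℝ) / lam⌉₊ : ℝ) ^ ((n : ℝ) / (⌈(n : ℝ) / lam⌉₊ : ℝ))) := by
  have hl : 0 < lam := by linarith
  set m := ⌈(n : ℝ) / lam⌉₊
  have hmn : m ≤ n := Nat.ceil_le.2 (div_le_self (Nat.cast_nonneg n) hlam.le)
  obtain ⟨R, hR, hle⟩ := exists_permanent_le_indicator hmn (lam⁻¹ • A)
    (fun i j => by simpa using mul_nonneg (inv_nonneg.2 hl.le) (h0 i j))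
    (fun i j => by
      rw [Matrix.smul_apply, smul_eq_mul, inv_mul_le_iff₀ hl, mul_one]
      exact hbd i j)
    (fun i => by
      simp only [Matrix.smul_apply, smul_eq_mul, ← Finset.mul_sum, hrow]
      rw [inv_mul_eq_div]
      exact Nat.le_ceil _)
  have hbreg := card_transversals_le R
  rw [permanent_indicator] at hle
  have hA : A = lam • (lam⁻¹ • A) := by rw [smul_smul, mul_inv_cancel₀ hl.ne', one_smul]
  rw [hA, permanent_smul]
  refine mul_le_mul_of_nonneg_left ((hle.trans hbreg).trans_eq ?_) (by positivity)
  rw [Real.rpow_def_of_pos (by positivity)]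
  simp only [hR, Finset.sum_const, Finset.card_univ, Fintype.card_fin, nsmul_eq_mul,
    logFactorialMean]
  congr 1
  ring
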